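/- Let X and Y be independent random variables on a probability space (Ω, 𝓕, ℙ), where X has the log-normal distribution with parameters μ = 0 and σ > 0 and Y has the Pareto distribution with shape a > 0 and scale θ > 0. Then for every z > 0, ℙ(X·Y ≤ z) = Φ( log(z/θ)/σ ) − θ^a·exp(a²σ²/2)·z^{-a}·Φ( (log(z/θ) − a·σ²)/σ ), where Φ is the cumulative distribution function of the standard Gaussian distribution. -/

import Mathlib

open MeasureTheory ProbabilityTheory Real

/-- The Pareto probability density function with shape `a` and scale `θ`. -/
noncomputable def paretoPdf (a θ x : ℝ) : ℝ :=
  if θ < x then a * θ ^ a * x ^ (-(a + 1)) else 0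

/-- The log-normal probability density function with parameters `μ` and `σ`. -/
noncomputable def logNormalPdf (μ σ x : ℝ) : ℝ :=
  if 0 < x then
    (1 / (Real.sqrt (2 * π) * σ * x)) * Real.exp (-(Real.log x - μ) ^ 2 / (2 * σ ^ 2))
  else 0

/-- The standard Gaussian cumulative distribution function. -/
noncomputable def stdGaussCdf (u : ℝ) : ℝ :=
  ∫ t in Set.Iic u, (1 / Real.sqrt (2 * π)) * Real.exp (-t ^ 2 / 2)

lemma withDensity_paretoPdf_Iic_of_le {a θ w : ℝ} (hw : w ≤ θ) :
    (volume : Measure ℝ).withDensity (fun y => ENNReal.ofReal (paretoPdf a θ y)) (Set.Iic w)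
      = 0 := by
  rw [withDensity_apply _ measurableSet_Iic]
  refine (setLIntegral_congr_fun (g := fun _ => 0) measurableSet_Iic ?_).trans (by simp)
  intro y hy
  have : ¬ θ < y := not_lt.2 (le_trans hy hw)
  simp [paretoPdf, this]

lemma withDensity_paretoPdf_Iic {a θ w : ℝ} (ha : 0 < a) (hθ : 0 < θ) (hw : θ ≤ w) :
    (volume : Measure ℝ).withDensity (fun y => ENNReal.ofReal (paretoPdf a θ y)) (Set.Iic w)
      = ENNReal.ofReal (1 - (θ / w) ^ a) := by
  have hw0 : 0 < w := hθ.trans_le hw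
  have h0 : (0 : ℝ) ∉ Set.uIcc θ w := by
    rw [Set.uIcc_of_le hw]
    exact fun h => absurd h.1 (not_le.2 hθ)
  have hval : ∫ y in Set.Ioc θ w, a * θ ^ a * y ^ (-(a + 1)) = 1 - (θ / w) ^ a := by
    rw [← intervalIntegral.integral_of_le hw, intervalIntegral.integral_const_mul,
      integral_rpow (Or.inr ⟨by linarith, h0⟩), show -(a + 1) + 1 = -a by ring,
      Real.rpow_neg hθ.le, Real.rpow_neg hw0.le, Real.div_rpow hθ.le hw0.le]
    have h1 := (Real.rpow_pos_of_pos hθ a).ne'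
    have h2 := (Real.rpow_pos_of_pos hw0 a).ne'
    field_simp
    ring
  have hint : IntegrableOn (fun y : ℝ => a * θ ^ a * y ^ (-(a + 1))) (Set.Ioc θ w) :=
    ((intervalIntegral.intervalIntegrable_rpow (Or.inr h0)).const_mul _).1
  rw [← hval, ofReal_integral_eq_lintegral_ofReal hint, withDensity_apply _ measurableSet_Iic,
    ← lintegral_indicator measurableSet_Iic, ← lintegral_indicator measurableSet_Ioc]
  · refine lintegral_congr fun y => ?_
    by_cases h1 : y ≤ w <;> by_cases h2 : θ < y <;> simp [paretoPdf, h1, h2]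
  · filter_upwards [ae_restrict_mem measurableSet_Ioc] with y hy
    have : 0 < y := hθ.trans hy.1
    simp only [Pi.zero_apply]
    positivity

lemma exp_mul_image_Iic {σ L : ℝ} (hσ : 0 < σ) :
    (fun t : ℝ => Real.exp (σ * t)) '' Set.Iic L = Set.Ioc 0 (Real.exp (σ * L)) := by
  ext x
  simp only [Set.mem_image, Set.mem_Iic, Set.mem_Ioc]
  constructor
  · rintro ⟨t, ht, rfl⟩
    exact ⟨Real.exp_pos _, by gcongr⟩
  · rintro ⟨hx, hxL⟩
    refine ⟨Real.log x / σ, ?_, ?_⟩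
    · rw [div_le_iff₀' hσ]
      exact (Real.log_le_iff_le_exp hx).2 hxL
    · rw [mul_div_cancel₀ _ hσ.ne', Real.exp_log hx]

lemma setLIntegral_logNormalPdf_mul {σ : ℝ} (hσ : 0 < σ) (L : ℝ) (g : ℝ → ENNReal) :
    ∫⁻ x in Set.Ioc 0 (Real.exp (σ * L)), ENNReal.ofReal (logNormalPdf 0 σ x) * g x
      = ∫⁻ t in Set.Iic L, ENNReal.ofReal ((1 / Real.sqrt (2 * π)) * Real.exp (-t ^ 2 / 2))
          * g (Real.exp (σ * t)) := by
  rw [← exp_mul_image_Iic hσ, lintegral_image_eq_lintegral_abs_deriv_mul measurableSet_Iic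
    (f' := fun t => Real.exp (σ * t) * σ)]
  · refine lintegral_congr fun t => ?_
    rw [← mul_assoc, ← ENNReal.ofReal_mul (abs_nonneg _), abs_of_pos (by positivity)]
    congr 2
    have : -(σ * t - 0) ^ 2 / (2 * σ ^ 2) = -t ^ 2 / 2 := by field_simp; ring
    rw [logNormalPdf, if_pos (Real.exp_pos _), Real.log_exp, this]
    field_simp
  · intro t _
    have := ((hasDerivAt_id t).const_mul σ).exp
    simpa using this.hasDerivWithinAt
  · intro s _ t _ h
    exact mul_left_cancel₀ hσ.ne' (Real.exp_injective h)

lemma integrable_stdGauss :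
    Integrable (fun t : ℝ => (1 / Real.sqrt (2 * π)) * Real.exp (-t ^ 2 / 2)) := by
  refine ((integrable_exp_neg_mul_sq (b := 1 / 2) (by norm_num)).const_mul (1 / Real.sqrt (2 * π))).congr ?_
  refine Filter.Eventually.of_forall fun t => ?_
  simp only
  congr 2
  ring

lemma stdGauss_mul_exp (b t : ℝ) :
    (1 / Real.sqrt (2 * π)) * Real.exp (-t ^ 2 / 2) * Real.exp (b * t)
      = Real.exp (b ^ 2 / 2)
        * ((1 / Real.sqrt (2 * π)) * Real.exp (-(t - b) ^ 2 / 2)) := by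
  have : Real.exp (-t ^ 2 / 2) * Real.exp (b * t)
      = Real.exp (b ^ 2 / 2) * Real.exp (-(t - b) ^ 2 / 2) := by
    rw [← Real.exp_add, ← Real.exp_add]
    congr 1
    ring
  linear_combination (1 / Real.sqrt (2 * π)) * this

lemma integrable_stdGauss_mul_exp (b : ℝ) :
    Integrable (fun t : ℝ =>
      (1 / Real.sqrt (2 * π)) * Real.exp (-t ^ 2 / 2) * Real.exp (b * t)) := by
  simp_rw [stdGauss_mul_exp]
  exact (integrable_stdGauss.comp_sub_right b).const_mul _

lemma setIntegral_stdGauss_mul_exp (b L : ℝ) :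
    ∫ t in Set.Iic L, (1 / Real.sqrt (2 * π)) * Real.exp (-t ^ 2 / 2) * Real.exp (b * t)
      = Real.exp (b ^ 2 / 2) * stdGaussCdf (L - b) := by
  simp_rw [stdGauss_mul_exp]
  have hpre : (fun t : ℝ => t - b) ⁻¹' Set.Iic (L - b) = Set.Iic L := by
    ext t
    simp
  have h := (measurePreserving_sub_right volume b).setIntegral_preimage_emb
    (MeasurableEquiv.subRight b).measurableEmbedding
    (fun t => (1 / Real.sqrt (2 * π)) * Real.exp (-t ^ 2 / 2)) (Set.Iic (L - b))
  rw [hpre] at h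
  rw [integral_const_mul, h, stdGaussCdf]

theorem product_of_lognormal_pareto_cdf
    {Ω : Type*} [MeasurableSpace Ω] (P : Measure Ω) [IsProbabilityMeasure P]
    (X Y : Ω → ℝ) (hXm : Measurable X) (hYm : Measurable Y)
    (hindep : IndepFun X Y P)
    (a θ σ : ℝ) (ha : 0 < a) (hθ : 0 < θ) (hσ : 0 < σ)
    (hX : Measure.map X P
      = (volume : Measure ℝ).withDensity (fun x => ENNReal.ofReal (logNormalPdf 0 σ x)))
    (hY : Measure.map Y P
      = (volume : Measure ℝ).withDensity (fun y => ENNReal.ofReal (paretoPdf a θ y))) :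
    ∀ z : ℝ, 0 < z →
      (P {ω | X ω * Y ω ≤ z}).toReal
        = stdGaussCdf (Real.log (z / θ) / σ)
          - θ ^ a * Real.exp (a ^ 2 * σ ^ 2 / 2) * z ^ (-a)
              * stdGaussCdf ((Real.log (z / θ) - a * σ ^ 2) / σ) := by
  intro z hz
  set L := Real.log (z / θ) / σ with hL
  have hzθ : 0 < z / θ := by positivity
  have hexpL : Real.exp (σ * L) = z / θ := by
    rw [hL, mul_div_cancel₀ _ hσ.ne', Real.exp_log hzθ]
  have hS : MeasurableSet {p : ℝ × ℝ | p.1 * p.2 ≤ z} :=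
    measurableSet_le (measurable_fst.mul measurable_snd) measurable_const
  have hmapY : IsProbabilityMeasure (Measure.map Y P) :=
    Measure.isProbabilityMeasure_map hYm.aemeasurable
  have hpdf : Measurable (fun x => ENNReal.ofReal (logNormalPdf 0 σ x)) := by
    refine ENNReal.measurable_ofReal.comp (Measurable.ite measurableSet_Ioi ?_ measurable_const)
    fun_prop
  have hslice {x : ℝ} (hx : 0 < x) :
      Prod.mk x ⁻¹' {p : ℝ × ℝ | p.1 * p.2 ≤ z} = Set.Iic (z / x) := by
    ext y
    simp [le_div_iff₀' hx]
  have hprod : P {ω | X ω * Y ω ≤ z}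
      = ∫⁻ x, ENNReal.ofReal (logNormalPdf 0 σ x)
          * Measure.map Y P (Prod.mk x ⁻¹' {p : ℝ × ℝ | p.1 * p.2 ≤ z}) := by
    have h := (indepFun_iff_map_prod_eq_prod_map_map hXm.aemeasurable hYm.aemeasurable).1 hindep
    have h2 := congrArg (fun m => m {p : ℝ × ℝ | p.1 * p.2 ≤ z}) h
    rw [Measure.map_apply (hXm.prodMk hYm) hS, Measure.prod_apply hS, hX,
      lintegral_withDensity_eq_lintegral_mul _ hpdf (measurable_measure_prodMk_left hS)] at h2
    exact h2
  have hrestrict : P {ω | X ω * Y ω ≤ z}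
      = ∫⁻ x in Set.Ioc 0 (Real.exp (σ * L)), ENNReal.ofReal (logNormalPdf 0 σ x)
          * ENNReal.ofReal (1 - (θ / (z / x)) ^ a) := by
    rw [hprod, ← lintegral_indicator measurableSet_Ioc, hexpL]
    refine lintegral_congr fun x => ?_
    rcases le_or_gt x 0 with hx | hx
    · simp [logNormalPdf, hx.not_gt]
    · rw [hslice hx, hY]
      by_cases hxz : x ≤ z / θ
      · rw [Set.indicator_of_mem (by exact ⟨hx, hxz⟩), withDensity_paretoPdf_Iic ha hθ]
        rwa [le_div_iff₀ hx, mul_comm, ← le_div_iff₀ hθ]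
      · rw [Set.indicator_of_notMem (fun h => hxz h.2), withDensity_paretoPdf_Iic_of_le, mul_zero]
        rw [div_le_iff₀ hx, mul_comm, ← div_le_iff₀ hθ]
        exact (not_le.1 hxz).le
  have hpow (t : ℝ) : (θ / (z / Real.exp (σ * t))) ^ a
      = θ ^ a * z ^ (-a) * Real.exp (a * σ * t) := by
    rw [show θ / (z / Real.exp (σ * t)) = θ / z * Real.exp (σ * t) by field_simp,
      Real.mul_rpow (by positivity) (by positivity), Real.div_rpow hθ.le hz.le,
      Real.rpow_neg hz.le, ← Real.exp_mul, div_eq_mul_inv]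
    congr 2
    ring
  have hpow_le {t : ℝ} (ht : t ≤ L) : (θ / (z / Real.exp (σ * t))) ^ a ≤ 1 := by
    refine Real.rpow_le_one (by positivity) ?_ ha.le
    rw [div_le_one (by positivity), le_div_iff₀ (by positivity), ← le_div_iff₀' hθ, ← hexpL]
    gcongr
  rw [hrestrict, setLIntegral_logNormalPdf_mul hσ]
  have hkey : (∫⁻ t in Set.Iic L,
        ENNReal.ofReal ((1 / Real.sqrt (2 * π)) * Real.exp (-t ^ 2 / 2))
          * ENNReal.ofReal (1 - (θ / (z / Real.exp (σ * t))) ^ a)).toReal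
      = ∫ t in Set.Iic L, ((1 / Real.sqrt (2 * π)) * Real.exp (-t ^ 2 / 2)
          - θ ^ a * z ^ (-a) *
            ((1 / Real.sqrt (2 * π)) * Real.exp (-t ^ 2 / 2) * Real.exp (a * σ * t))) := by
    have heq (t : ℝ) : (1 / Real.sqrt (2 * π)) * Real.exp (-t ^ 2 / 2)
          - θ ^ a * z ^ (-a) *
            ((1 / Real.sqrt (2 * π)) * Real.exp (-t ^ 2 / 2) * Real.exp (a * σ * t))
        = (1 / Real.sqrt (2 * π)) * Real.exp (-t ^ 2 / 2)
          * (1 - (θ / (z / Real.exp (σ * t))) ^ a) := by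
      rw [hpow]
      ring
    rw [integral_eq_lintegral_of_nonneg_ae]
    · congr 1
      refine lintegral_congr fun t => ?_
      rw [heq, ENNReal.ofReal_mul (p := (1 / Real.sqrt (2 * π)) * Real.exp (-t ^ 2 / 2))
        (by positivity)]
    · filter_upwards [ae_restrict_mem measurableSet_Iic] with t ht
      rw [heq]
      exact mul_nonneg (by positivity) (sub_nonneg.2 (hpow_le ht))
    · exact Measurable.aestronglyMeasurable (by fun_prop)
  rw [hkey, integral_sub integrable_stdGauss.integrableOn
    ((integrable_stdGauss_mul_exp _).const_mul _).integrableOn,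
    integral_const_mul (θ ^ a * z ^ (-a)),
    setIntegral_stdGauss_mul_exp, ← stdGaussCdf,
    show (Real.log (z / θ) - a * σ ^ 2) / σ = L - a * σ by rw [hL]; field_simp,
    show (a * σ) ^ 2 = a ^ 2 * σ ^ 2 by ring]
  ring
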